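/- arXiv:2604.09667 — 2 statements merged into one kernel-verified Lean document; each statement's English description precedes it below -/
import Mathlib

section
/- Let μ be a probability measure on ℝ and c ∈ ℝ. There exists a probability measure ν on ℝ that is symmetric about c and stochastically dominates μ if and only if the reflection of μ about c stochastically dominates μ. Consequently, the set of admissible centers c for a symmetric stochastically dominating measure is exactly the set of c such that the reflection of μ about c stochastically dominates μ. -/
open MeasureTheory

/-- `ν` stochastically dominates `μ`: `ν((x,∞)) ≥ μ((x,∞))` for all `x`. -/
def StochDom (μ ν : Measure ℝ) : Prop :=
  ∀ x : ℝ, μ (Set.Ioi x) ≤ ν (Set.Ioi x)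

/-- The reflection of a measure `μ` about `c`: pushforward under `x ↦ 2c − x`. -/
noncomputable def reflect (μ : Measure ℝ) (c : ℝ) : Measure ℝ :=
  μ.map (fun x => 2 * c - x)

/-- `μ` is symmetric about `c` if it equals its reflection about `c`. -/
def SymmAbout (μ : Measure ℝ) (c : ℝ) : Prop :=
  μ = reflect μ c

lemma reflect_apply (μ : Measure ℝ) (c : ℝ) {s : Set ℝ} (hs : MeasurableSet s) :
    reflect μ c s = μ ((fun x => 2 * c - x) ⁻¹' s) :=
  Measure.map_apply (by fun_prop) hs

lemma reflect_Ioi (μ : Measure ℝ) (c x : ℝ) :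
    reflect μ c (Set.Ioi x) = μ (Set.Iio (2 * c - x)) := by
  rw [reflect_apply μ c measurableSet_Ioi, Set.preimage_const_sub_Ioi]

lemma reflect_Ici (μ : Measure ℝ) (c x : ℝ) :
    reflect μ c (Set.Ici x) = μ (Set.Iic (2 * c - x)) := by
  rw [reflect_apply μ c measurableSet_Ici, Set.preimage_const_sub_Ici]

lemma reflect_Iic (μ : Measure ℝ) (c x : ℝ) :
    reflect μ c (Set.Iic x) = μ (Set.Ici (2 * c - x)) := by
  rw [reflect_apply μ c measurableSet_Iic, Set.preimage_const_sub_Iic]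

lemma reflect_add (μ ν : Measure ℝ) (c : ℝ) :
    reflect (μ + ν) c = reflect μ c + reflect ν c :=
  Measure.map_add μ ν (by fun_prop)

lemma reflect_smul_dirac (a : ENNReal) (c : ℝ) :
    reflect (a • Measure.dirac c) c = a • Measure.dirac c := by
  rw [reflect, Measure.map_smul, Measure.map_dirac' (f := fun x : ℝ => 2 * c - x) (by fun_prop)]
  ring_nf

lemma reflect_reflect (μ : Measure ℝ) (c : ℝ) : reflect (reflect μ c) c = μ := by
  rw [reflect, reflect, Measure.map_map (by fun_prop) (by fun_prop)]
  convert Measure.map_id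
  ext x
  simp

instance isProbabilityMeasure_reflect (μ : Measure ℝ) [IsProbabilityMeasure μ] (c : ℝ) :
    IsProbabilityMeasure (reflect μ c) :=
  Measure.isProbabilityMeasure_map (by fun_prop)

/-- Stochastic domination also compares the measures of closed upper half-lines. -/
lemma StochDom.measure_Ici_le {μ ν : Measure ℝ} [IsFiniteMeasure ν] (h : StochDom μ ν) (x : ℝ) :
    μ (Set.Ici x) ≤ ν (Set.Ici x) := by
  obtain ⟨u, hu, hux, hlim⟩ := exists_seq_strictMono_tendsto x
  have hInter : ⋂ n, Set.Ioi (u n) = Set.Ici x := by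
    ext y
    simp only [Set.mem_iInter, Set.mem_Ioi, Set.mem_Ici]
    exact ⟨fun hy => le_of_tendsto' hlim fun n => (hy n).le, fun hy n => (hux n).trans_le hy⟩
  have ht := tendsto_measure_iInter_atTop (μ := ν) (s := fun n => Set.Ioi (u n))
    (fun n => measurableSet_Ioi.nullMeasurableSet)
    (fun m n hmn => Set.Ioi_subset_Ioi (hu.monotone hmn)) ⟨0, measure_ne_top _ _⟩
  rw [hInter] at ht
  exact ge_of_tendsto' ht fun n =>
    (measure_mono fun y hy => (hux n).trans_le hy).trans (h (u n))

/-- A measure dominated by a measure symmetric about `c` is dominated by its reflection. -/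
lemma StochDom.reflect_of_symmAbout {μ ν : Measure ℝ} [IsProbabilityMeasure μ]
    [IsProbabilityMeasure ν] {c : ℝ} (h : StochDom μ ν) (hν : SymmAbout ν c) :
    StochDom μ (reflect μ c) := by
  intro x
  refine (h x).trans ?_
  rw [hν, reflect_Ioi, reflect_Ioi, ← Set.compl_Ici, prob_compl_eq_one_sub measurableSet_Ici,
    prob_compl_eq_one_sub measurableSet_Ici]
  exact tsub_le_tsub_left (h.measure_Ici_le _) 1

/-- The part of `μ` above `c`, together with its mirror image, and an atom at `c` that brings
the total mass to one when `μ (Ioi c) ≤ 1 / 2`. -/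
noncomputable def upperSymmetrization (μ : Measure ℝ) (c : ℝ) : Measure ℝ :=
  μ.restrict (Set.Ioi c) + reflect (μ.restrict (Set.Ioi c)) c +
    (1 - (μ (Set.Ioi c) + μ (Set.Ioi c))) • Measure.dirac c

lemma symmAbout_upperSymmetrization (μ : Measure ℝ) (c : ℝ) :
    SymmAbout (upperSymmetrization μ c) c := by
  rw [SymmAbout, upperSymmetrization, reflect_add, reflect_add, reflect_smul_dirac,
    reflect_reflect, add_comm (reflect _ c)]

lemma isProbabilityMeasure_upperSymmetrization {μ : Measure ℝ} {c : ℝ}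
    (h : μ (Set.Ioi c) + μ (Set.Ioi c) ≤ 1) :
    IsProbabilityMeasure (upperSymmetrization μ c) := by
  constructor
  simp [upperSymmetrization, reflect_apply _ _ MeasurableSet.univ, add_tsub_cancel_of_le h]

lemma upperSymmetrization_Iic (μ : Measure ℝ) {c x : ℝ} (hx : x < c) :
    upperSymmetrization μ c (Set.Iic x) = μ (Set.Ici (2 * c - x)) := by
  have h₁ : Set.Iic x ∩ Set.Ioi c = ∅ := by
    ext y
    simp only [Set.mem_inter_iff, Set.mem_Iic, Set.mem_Ioi, Set.mem_empty_iff_false]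
    constructor <;> intros <;> grind
  have h₂ : Set.Ici (2 * c - x) ∩ Set.Ioi c = Set.Ici (2 * c - x) :=
    Set.inter_eq_left.2 fun y (hy : 2 * c - x ≤ y) => show c < y by linarith
  simp [upperSymmetrization, reflect_Iic, h₁, h₂, hx]

lemma measure_Ioi_le_upperSymmetrization (μ : Measure ℝ) {c x : ℝ} (hx : c ≤ x) :
    μ (Set.Ioi x) ≤ upperSymmetrization μ c (Set.Ioi x) := by
  have h : Set.Ioi x ∩ Set.Ioi c = Set.Ioi x := Set.inter_eq_left.2 (Set.Ioi_subset_Ioi hx)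
  rw [upperSymmetrization, Measure.add_apply, Measure.add_apply,
    Measure.restrict_apply measurableSet_Ioi, h, add_assoc]
  exact le_self_add

lemma StochDom.measure_Ioi_add_self_le_one {μ : Measure ℝ} [IsProbabilityMeasure μ] {c : ℝ}
    (h : StochDom μ (reflect μ c)) : μ (Set.Ioi c) + μ (Set.Ioi c) ≤ 1 := by
  have hc := h c
  rw [reflect_Ioi, show 2 * c - c = c by ring] at hc
  calc μ (Set.Ioi c) + μ (Set.Ioi c) ≤ μ (Set.Iio c) + μ (Set.Ioi c) := by gcongr
    _ = μ (Set.Iio c ∪ Set.Ioi c) :=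
      (measure_union (Set.Iio_disjoint_Ioi_same) measurableSet_Ioi).symm
    _ ≤ 1 := prob_le_one

lemma stochDom_upperSymmetrization {μ : Measure ℝ} [IsProbabilityMeasure μ] {c : ℝ}
    (h : StochDom μ (reflect μ c)) : StochDom μ (upperSymmetrization μ c) := by
  intro x
  rcases le_or_gt c x with hx | hx
  · exact measure_Ioi_le_upperSymmetrization μ hx
  · have := isProbabilityMeasure_upperSymmetrization h.measure_Ioi_add_self_le_one
    rw [← Set.compl_Iic, prob_compl_eq_one_sub measurableSet_Iic,
      prob_compl_eq_one_sub measurableSet_Iic, upperSymmetrization_Iic μ hx]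
    refine tsub_le_tsub_left ?_ 1
    simpa [reflect_Ici] using h.measure_Ici_le (2 * c - x)

/-- There exists a probability measure `ν` symmetric about `c` stochastically dominating `μ`
iff the reflection of `μ` about `c` stochastically dominates `μ`; consequently, the set of
admissible centers equals the set of centers `c` with `reflect μ c` dominating `μ`. -/
theorem exists_symm_dom_iff_reflect_dom (μ : Measure ℝ) [IsProbabilityMeasure μ] :
    (∀ c : ℝ,
      (∃ ν : Measure ℝ, IsProbabilityMeasure ν ∧ SymmAbout ν c ∧ StochDom μ ν) ↔
        StochDom μ (reflect μ c)) ∧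
    {c : ℝ | ∃ ν : Measure ℝ, IsProbabilityMeasure ν ∧ SymmAbout ν c ∧ StochDom μ ν} =
      {c : ℝ | StochDom μ (reflect μ c)} := by
  have key : ∀ c : ℝ,
      (∃ ν : Measure ℝ, IsProbabilityMeasure ν ∧ SymmAbout ν c ∧ StochDom μ ν) ↔
        StochDom μ (reflect μ c) := by
    refine fun c => ⟨?_, fun h => ⟨upperSymmetrization μ c,
      isProbabilityMeasure_upperSymmetrization h.measure_Ioi_add_self_le_one,
      symmAbout_upperSymmetrization μ c, stochDom_upperSymmetrization h⟩⟩
    rintro ⟨ν, _, hν, h⟩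
    exact h.reflect_of_symmAbout hν
  exact ⟨key, Set.ext key⟩
end

section
/- Let n ∈ ℕ and let r_1 ≥ r_2 ≥ … ≥ r_n ≥ 0 be real numbers. Let g : {0,1,…,n} → ℕ be nondecreasing with g(0) = 0. Define subsets S_0, …, S_n of {1,…,n} by S_0 = ∅ and, for 1 ≤ i ≤ n, S_i = S_{i−1} ∪ {i} if g(i) > g(i−1), and S_i = S_{i−1} otherwise. Suppose M_0, …, M_n are subsets of {1,…,n} such that, for every i, M_i ⊆ {1,…,i} and |M_i| ≥ g(i), and for every 0 ≤ i < n either M_{i+1} = M_i or M_{i+1} = M_i ∪ {w} for some w ∈ {1,…,i+1} with w ∉ M_i. Then for every i ∈ {0,…,n}, the set M_i r-dominates S_i. -/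
open Finset

/-- The `k`-th largest value of `r` on the finite set `V` (for `1 ≤ k ≤ |V|`): the entry at
position `|V| − k` of the list of values of `r` on `V` sorted in nondecreasing order. -/
noncomputable def kthLargest {ι : Type*} (r : ι → ℝ) (V : Finset ι) (k : ℕ) : ℝ :=
  ((V.val.map r).sort (· ≤ ·)).getD (V.card - k) 0

/-- `V` `r`-dominates `W`: `|V| ≥ |W|` and for every `1 ≤ k ≤ |W|`, the `k`-th largest value
of `r` on `V` is at least the `k`-th largest value of `r` on `W`. -/
def RDominates {ι : Type*} (r : ι → ℝ) (V W : Finset ι) : Prop :=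
  W.card ≤ V.card ∧ ∀ k : ℕ, 1 ≤ k → k ≤ W.card → kthLargest r W k ≤ kthLargest r V k

/-- The greedily constructed certificate sets: `S_0 = ∅`, and `S_{i+1}` adds item `i+1`
(0-indexed: `⟨i, _⟩`) exactly when the lower bound `g` increases at step `i+1`. -/
def certSet (n : ℕ) (g : ℕ → ℕ) : ℕ → Finset (Fin n)
  | 0 => ∅
  | i + 1 =>
    if h : i < n then
      if g i < g (i + 1) then insert (⟨i, h⟩ : Fin n) (certSet n g i) else certSet n g i
    else certSet n g i

/-- In a nondecreasing list, at least `k` entries are `≥ c` iff the entry at position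
`length - k` is. -/
lemma List.le_getElem_length_sub_iff_le_countP {l : List ℝ} (hl : l.Pairwise (· ≤ ·)) {k : ℕ}
    (c : ℝ) (hkl : k ≤ l.length) (hk : l.length - k < l.length) :
    c ≤ l[l.length - k] ↔ k ≤ l.countP (c ≤ ·) := by
  have hmono : ∀ (i j : ℕ) (hi : i < l.length) (hj : j < l.length), i ≤ j → l[i] ≤ l[j] := by
    intro i j hi hj hij
    rcases hij.eq_or_lt with rfl | hlt
    · rfl
    · exact List.pairwise_iff_getElem.mp hl i j hi hj hlt
  constructor
  · intro hc
    have hdrop : (l.drop (l.length - k)).countP (c ≤ ·) = (l.drop (l.length - k)).length := by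
      rw [List.countP_eq_length]
      intro a ha
      obtain ⟨j, hj, rfl⟩ := List.mem_iff_getElem.mp ha
      rw [List.length_drop] at hj
      simpa using hc.trans (hmono _ _ hk (by omega) (Nat.le_add_right _ j))
    have hle := (List.drop_sublist (l.length - k) l).countP_le (p := (c ≤ ·))
    rw [hdrop, List.length_drop] at hle
    omega
  · intro hcount
    by_contra! hc
    have htake : (l.take (l.length - k + 1)).countP (c ≤ ·) = 0 := by
      rw [List.countP_eq_zero]
      intro a ha
      obtain ⟨j, hj, rfl⟩ := List.mem_iff_getElem.mp ha
      rw [List.length_take] at hj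
      simpa using (hmono j _ (by omega) hk (by omega)).trans_lt hc
    have hsplit := List.countP_append (p := (c ≤ ·)) (l₁ := l.take (l.length - k + 1))
      (l₂ := l.drop (l.length - k + 1))
    have hle := List.countP_le_length (p := (c ≤ ·)) (l := l.drop (l.length - k + 1))
    rw [List.take_append_drop] at hsplit
    rw [List.length_drop] at hle
    omega

lemma le_kthLargest_iff {ι : Type*} (r : ι → ℝ) (V : Finset ι) {k : ℕ} (hk1 : 1 ≤ k)
    (hk : k ≤ V.card) (c : ℝ) :
    c ≤ kthLargest r V k ↔ k ≤ (V.filter fun v => c ≤ r v).card := by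
  have hlen : ((V.val.map r).sort (· ≤ ·)).length = V.card := by simp
  have hlt : ((V.val.map r).sort (· ≤ ·)).length - k < ((V.val.map r).sort (· ≤ ·)).length := by
    omega
  have hcount : ((V.val.map r).sort (· ≤ ·)).countP (c ≤ ·) =
      (V.filter fun v => c ≤ r v).card := by
    rw [← Multiset.coe_countP, Multiset.sort_eq, Multiset.countP_map]
    rfl
  rw [← hcount, ← List.le_getElem_length_sub_iff_le_countP (Multiset.pairwise_sort _ _) c
    (hlen ▸ hk) hlt, kthLargest, ← hlen, List.getD_eq_getElem _ _ hlt]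

/-- Domination follows from comparing the sizes of all superlevel sets. -/
lemma RDominates.of_card_filter_le {ι : Type*} {r : ι → ℝ} {V W : Finset ι}
    (hcard : W.card ≤ V.card)
    (h : ∀ c : ℝ, (W.filter fun w => c ≤ r w).card ≤ (V.filter fun v => c ≤ r v).card) :
    RDominates r V W :=
  ⟨hcard, fun _ hk1 hk => (le_kthLargest_iff r V hk1 (hk.trans hcard) _).mpr <|
    ((le_kthLargest_iff r W hk1 hk _).mp le_rfl).trans (h _)⟩

lemma card_certSet_le {n : ℕ} {g : ℕ → ℕ} (hgmono : ∀ i j, i ≤ j → j ≤ n → g i ≤ g j) :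
    ∀ i, i ≤ n → (certSet n g i).card ≤ g i
  | 0, _ => by simp [certSet]
  | i + 1, hi => by
    have ih := card_certSet_le hgmono i (by omega)
    have hg := hgmono i (i + 1) (by omega) hi
    rw [certSet, dif_pos (by omega)]
    split_ifs with hlt
    · exact (card_insert_le _ _).trans (by omega)
    · exact ih.trans hg

/-- Lemma of Appendix B: with items sorted by radius `r` in nonincreasing order, a
nondecreasing lower bound `g` with `g 0 = 0` on `|M_i|`, and sets `M_i ⊆ {1,…,i}` growing by
at most one element per step, every `M_i` `r`-dominates the certificate set `S_i`. -/
theorem maxSet_rDominates_certSet (n : ℕ) (r : Fin n → ℝ) (hr : Antitone r)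
    (hnn : ∀ i, 0 ≤ r i)
    (g : ℕ → ℕ) (hg0 : g 0 = 0) (hgmono : ∀ i j, i ≤ j → j ≤ n → g i ≤ g j)
    (M : ℕ → Finset (Fin n))
    (hMsub : ∀ i, i ≤ n → ∀ j ∈ M i, (j : ℕ) < i)
    (hMcard : ∀ i, i ≤ n → g i ≤ (M i).card)
    (hMstep : ∀ i, i < n →
      M (i + 1) = M i ∨
        ∃ w : Fin n, (w : ℕ) < i + 1 ∧ w ∉ M i ∧ M (i + 1) = insert w (M i)) :
    ∀ i, i ≤ n → RDominates r (M i) (certSet n g i) := by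
  intro i hi
  refine .of_card_filter_le ((card_certSet_le hgmono i hi).trans (hMcard i hi)) fun c => ?_
  induction i with
  | zero => simp [certSet]
  | succ i ih =>
    have hsub : M i ⊆ M (i + 1) := by
      rcases hMstep i hi with h | ⟨w, -, -, h⟩
      · exact h.ge
      · exact h ▸ subset_insert w (M i)
    by_cases hc : c ≤ r ⟨i, hi⟩
    · have hall : (M (i + 1)).filter (fun v => c ≤ r v) = M (i + 1) :=
        filter_true_of_mem fun v hv =>
          hc.trans (hr (Nat.le_of_lt_succ (hMsub (i + 1) hi v hv)))
      rw [hall]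
      exact (card_filter_le _ _).trans
        ((card_certSet_le hgmono (i + 1) hi).trans (hMcard (i + 1) hi))
    · have hstep : (certSet n g (i + 1)).filter (fun v => c ≤ r v) =
          (certSet n g i).filter (fun v => c ≤ r v) := by
        rw [certSet, dif_pos (Nat.lt_of_succ_le hi)]
        split_ifs
        · rw [filter_insert, if_neg hc]
        · rfl
      rw [hstep]
      exact (ih (by omega)).trans (card_le_card (filter_subset_filter _ hsub))
end
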